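/- Let R > 0 and let Λ ⊂ ℝ² be a unimodular lattice such that every nonzero λ = (λ₁, λ₂) ∈ Λ with λ₂ = 0 satisfies |λ₁| > 2R. Then there exists a positive basis (γ⁺, γ⁻) of Λ whose second coordinates γ₂⁺ and γ₂⁻ both satisfy 0 ≤ γ₂⁺ < 1/(2R) and 0 < γ₂⁻ < 1/(2R). -/

import Mathlib

/-- The set ℝ₊₊ = {(x, y) : x > 0, y ≥ 0}. -/
def Rpp : Set (ℝ × ℝ) := {p | 0 < p.1 ∧ 0 ≤ p.2}

/-- The set ℝ₋₊ = {(x, y) : x ≤ 0, y > 0}. -/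
def Rmp : Set (ℝ × ℝ) := {p | p.1 ≤ 0 ∧ 0 < p.2}

/-- The lattice ℤa + ℤb spanned by two vectors. -/
def latticeOf (a b : ℝ × ℝ) : Set (ℝ × ℝ) :=
  {v | ∃ m n : ℤ, v = (m : ℝ) • a + (n : ℝ) • b}

lemma latticeOf_comm (a b : ℝ × ℝ) : latticeOf a b = latticeOf b a := by
  ext v
  constructor <;> rintro ⟨m, n, rfl⟩ <;> exact ⟨n, m, add_comm _ _⟩

lemma latticeOf_sub_smul_right (a b : ℝ × ℝ) (k : ℤ) :
    latticeOf a (b - (k : ℝ) • a) = latticeOf a b := by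
  ext v
  constructor
  · rintro ⟨m, n, rfl⟩
    refine ⟨m - n * k, n, ?_⟩
    push_cast
    module
  · rintro ⟨m, n, rfl⟩
    refine ⟨m + n * k, n, ?_⟩
    push_cast
    module

lemma latticeOf_sub_smul_left (a b : ℝ × ℝ) (k : ℤ) :
    latticeOf (a - (k : ℝ) • b) b = latticeOf a b := by
  rw [latticeOf_comm, latticeOf_sub_smul_right, latticeOf_comm]

lemma latticeOf_neg_right (a b : ℝ × ℝ) : latticeOf a (-b) = latticeOf a b := by
  ext v
  constructor <;> rintro ⟨m, n, rfl⟩ <;> refine ⟨m, -n, ?_⟩ <;> push_cast <;> module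

lemma latticeOf_neg_left (a b : ℝ × ℝ) : latticeOf (-a) b = latticeOf a b := by
  rw [latticeOf_comm, latticeOf_neg_right, latticeOf_comm]

/-- An oriented unimodular basis of `Λ` whose heights are reduced: `0 ≤ u₂ < v₂`. -/
structure IsReducedBasis (Λ : Set (ℝ × ℝ)) (u v : ℝ × ℝ) : Prop where
  eq : Λ = latticeOf u v
  det : u.1 * v.2 - u.2 * v.1 = 1
  nonneg : 0 ≤ u.2
  lt : u.2 < v.2

/-- Every unimodular lattice has a reduced basis. -/
lemma exists_isReducedBasis (a b : ℝ × ℝ) (hdet : |a.1 * b.2 - a.2 * b.1| = 1) :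
    ∃ u v, IsReducedBasis (latticeOf a b) u v := by
  wlog hb : b.2 ≠ 0 generalizing a b
  · rw [latticeOf_comm]
    refine this b a ?_ fun ha => ?_
    · rw [← hdet, abs_sub_comm]
      ring_nf
    · simp [not_not.mp hb, ha] at hdet
  wlog hpos : 0 < b.2 generalizing b
  · rw [← latticeOf_neg_right]
    refine this (-b) ?_ (by simpa using hb) ?_
    · rw [← hdet, ← abs_neg]
      simp only [Prod.fst_neg, Prod.snd_neg]
      ring_nf
    · simpa using lt_of_le_of_ne (not_lt.mp hpos) hb
  wlog hone : a.1 * b.2 - a.2 * b.1 = 1 generalizing a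
  · rw [← latticeOf_neg_left]
    have hneg := (eq_or_eq_neg_of_abs_eq hdet).resolve_left hone
    have h' : (-a).1 * b.2 - (-a).2 * b.1 = 1 := by
      simp only [Prod.fst_neg, Prod.snd_neg]
      linarith
    exact this (-a) (by rw [h', abs_one]) h'
  have h₁ := Int.floor_le (a.2 / b.2)
  have h₂ := Int.lt_floor_add_one (a.2 / b.2)
  rw [le_div_iff₀ hpos] at h₁
  rw [div_lt_iff₀ hpos] at h₂
  refine ⟨a - (⌊a.2 / b.2⌋ : ℝ) • b, b, (latticeOf_sub_smul_left a b _).symm, ?_, ?_, ?_⟩ <;>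
    simp only [Prod.fst_sub, Prod.snd_sub, Prod.smul_fst, Prod.smul_snd, smul_eq_mul] <;>
    linarith

/-- One round of the Euclidean algorithm on the heights of a reduced basis. -/
lemma IsReducedBasis.exists_euclid_step {Λ : Set (ℝ × ℝ)} {u v : ℝ × ℝ}
    (h : IsReducedBasis Λ u v) (hu : 0 < u.2) :
    ∃ u' v', IsReducedBasis Λ u' v' ∧ v'.2 ≤ v.2 / 2 ∧
      (u.1 ≤ 0 → u.1 + 1 / v.2 ≤ u'.1) ∧ (0 < u.1 → 0 < u'.1) ∧
      (0 < u.1 → v'.1 ≤ v.1 - u.1) := by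
  obtain ⟨hΛ, hdet, -, hlt⟩ := h
  obtain ⟨k, hk⟩ : ∃ k : ℤ, k = ⌈v.2 / u.2⌉ - 1 := ⟨_, rfl⟩
  have hk₁ : (1 : ℝ) ≤ k := by
    have : 1 < ⌈v.2 / u.2⌉ := Int.lt_ceil.mpr (by rw [lt_div_iff₀ hu]; simpa using hlt)
    exact_mod_cast (by lia : 1 ≤ k)
  have hk₂ : k * u.2 < v.2 := by
    have := Int.ceil_lt_add_one (v.2 / u.2)
    rw [← lt_div_iff₀ hu, hk]
    push_cast
    linarith
  have hk₃ : v.2 ≤ (k + 1) * u.2 := by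
    have := Int.le_ceil (v.2 / u.2)
    rw [← div_le_iff₀ hu, hk]
    push_cast
    linarith
  obtain ⟨w, hw⟩ : ∃ w, w = v - (k : ℝ) • u := ⟨_, rfl⟩
  have hw₁ : w.1 = v.1 - k * u.1 := by simp [hw]
  have hw₂ : w.2 = v.2 - k * u.2 := by simp [hw]
  have hwpos : 0 < w.2 := by linarith
  have hwu : w.2 ≤ u.2 := by linarith
  have hwdet : u.1 * w.2 - u.2 * w.1 = 1 := by rw [hw₁, hw₂]; linarith
  obtain ⟨l, hl⟩ : ∃ l : ℤ, l = ⌊u.2 / w.2⌋ := ⟨_, rfl⟩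
  have hl₁ : (1 : ℝ) ≤ l := by
    have : 1 ≤ ⌊u.2 / w.2⌋ := Int.le_floor.mpr (by rw [le_div_iff₀ hwpos]; simpa using hwu)
    exact_mod_cast hl ▸ this
  have hl₂ := Int.floor_le (u.2 / w.2)
  have hl₃ := Int.lt_floor_add_one (u.2 / w.2)
  rw [← hl, le_div_iff₀ hwpos] at hl₂
  rw [← hl, div_lt_iff₀ hwpos] at hl₃
  obtain ⟨t, ht⟩ : ∃ t, t = u - (l : ℝ) • w := ⟨_, rfl⟩
  have ht₁ : t.1 = u.1 - l * w.1 := by simp [ht]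
  have ht₂ : t.2 = u.2 - l * w.2 := by simp [ht]
  have htdet : t.1 * w.2 - t.2 * w.1 = 1 := by rw [ht₁, ht₂]; linarith
  have ht0 : 0 ≤ t.2 := by linarith
  refine ⟨t, w, ⟨?_, htdet, ht0, by linarith⟩, ?_, fun hx => ?_, fun hx => ?_, fun hx => ?_⟩
  · rw [ht, latticeOf_sub_smul_left, hw, latticeOf_sub_smul_right, hΛ]
  · nlinarith
  · have h₁ : 1 / v.2 ≤ 1 / u.2 := one_div_le_one_div_of_le hu hlt.le
    have h₂ : 1 / u.2 ≤ -w.1 := by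
      rw [div_le_iff₀ hu]
      nlinarith
    have h₃ : 0 < 1 / u.2 := by positivity
    nlinarith
  · rcases le_or_gt 0 w.1 with hw0 | hw0
    · have : 0 < t.1 * w.2 := by nlinarith
      exact pos_of_mul_pos_left this hwpos.le
    · nlinarith
  · nlinarith

/-- `Λ` has a positive basis whose heights are both less than `H`. -/
def HasLowPositiveBasis (Λ : Set (ℝ × ℝ)) (H : ℝ) : Prop :=
  ∃ gp gm : ℝ × ℝ, gp ∈ Rpp ∧ gm ∈ Rmp ∧ Λ = latticeOf gp gm ∧
    0 ≤ gp.2 ∧ gp.2 < H ∧ 0 < gm.2 ∧ gm.2 < H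

section

variable {Λ : Set (ℝ × ℝ)} {R : ℝ} {u v : ℝ × ℝ}

lemma IsReducedBasis.hasLowPositiveBasis_of_snd_eq_zero (h : IsReducedBasis Λ u v) (hR : 0 < R)
    (hadm : ∀ l ∈ Λ, l ≠ 0 → l.2 = 0 → 2 * R < |l.1|) (hu : u.2 = 0) :
    HasLowPositiveBasis Λ (1 / (2 * R)) := by
  obtain ⟨hΛ, hdet, -, hlt⟩ := h
  rw [hu] at hlt
  have hdet' : u.1 * v.2 = 1 := by simpa [hu] using hdet
  have hx : 0 < u.1 := pos_of_mul_pos_left (by linarith) hlt.le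
  have hlong : 2 * R < u.1 := by
    have := hadm u (hΛ ▸ ⟨1, 0, by simp⟩) (fun h0 => by simp [h0] at hx) hu
    rwa [abs_of_pos hx] at this
  have hv : v.2 < 1 / (2 * R) := by
    rw [lt_div_iff₀ (by positivity)]
    nlinarith
  have hceil := Int.le_ceil (v.1 / u.1)
  rw [div_le_iff₀ hx] at hceil
  refine ⟨u, v - (⌈v.1 / u.1⌉ : ℝ) • u, ⟨hx, hu.ge⟩, ⟨?_, ?_⟩, ?_, hu.ge, ?_, ?_, ?_⟩
  · simpa using hceil
  · simpa [hu] using hlt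
  · rw [latticeOf_sub_smul_right, hΛ]
  · rw [hu]
    positivity
  · simpa [hu] using hlt
  · simpa [hu] using hv

lemma IsReducedBasis.hasLowPositiveBasis_of_pos_of_nonpos (h : IsReducedBasis Λ u v) (hR : 0 < R)
    (hadm : ∀ l ∈ Λ, l ≠ 0 → l.2 = 0 → 2 * R < |l.1|) (hu : 0 < u.1) (hv : v.1 ≤ 0) :
    HasLowPositiveBasis Λ (1 / (2 * R)) := by
  obtain ⟨n, hn⟩ : ∃ n : ℕ, v.2 < 2 ^ n * (1 / (2 * R)) := by
    obtain ⟨n, hn⟩ := pow_unbounded_of_one_lt (v.2 / (1 / (2 * R))) one_lt_two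
    exact ⟨n, (div_lt_iff₀ (by positivity)).mp hn⟩
  induction n generalizing u v with
  | zero =>
    rw [pow_zero, one_mul] at hn
    have hvpos := h.nonneg.trans_lt h.lt
    exact ⟨u, v, ⟨hu, h.nonneg⟩, ⟨hv, hvpos⟩, h.eq, h.nonneg, h.lt.trans hn, hvpos, hn⟩
  | succ n ih =>
    rcases h.nonneg.eq_or_lt with h0 | h0
    · exact h.hasLowPositiveBasis_of_snd_eq_zero hR hadm h0.symm
    obtain ⟨u', v', h', hhalf, -, hu', hv'⟩ := h.exists_euclid_step h0
    refine ih h' (hu' hu) (by linarith [hv' hu]) ?_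
    rw [pow_succ] at hn
    linarith

lemma IsReducedBasis.hasLowPositiveBasis_of_pos (h : IsReducedBasis Λ u v) (hR : 0 < R)
    (hadm : ∀ l ∈ Λ, l ≠ 0 → l.2 = 0 → 2 * R < |l.1|) (hu : 0 < u.1) :
    HasLowPositiveBasis Λ (1 / (2 * R)) := by
  obtain ⟨Y, hY⟩ : ∃ Y, v.2 ≤ Y := ⟨_, le_rfl⟩
  have hY0 : 0 < Y := (h.nonneg.trans_lt h.lt).trans_le hY
  obtain ⟨n, hn⟩ : ∃ n : ℕ, v.1 ≤ n * (1 / Y) := by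
    obtain ⟨n, hn⟩ := exists_nat_ge (v.1 / (1 / Y))
    exact ⟨n, (div_le_iff₀ (by positivity)).mp hn⟩
  induction n generalizing u v with
  | zero => exact h.hasLowPositiveBasis_of_pos_of_nonpos hR hadm hu (by simpa using hn)
  | succ n ih =>
    rcases h.nonneg.eq_or_lt with h0 | h0
    · exact h.hasLowPositiveBasis_of_snd_eq_zero hR hadm h0.symm
    rcases le_or_gt v.1 0 with hv | hv
    · exact h.hasLowPositiveBasis_of_pos_of_nonpos hR hadm hu hv
    obtain ⟨u', v', h', hhalf, -, hu', hv'⟩ := h.exists_euclid_step h0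
    have hvpos := h0.trans h.lt
    refine ih h' (hu' hu) (by linarith) ?_
    have hdrop : 1 / Y ≤ u.1 := by
      rw [div_le_iff₀ hY0]
      nlinarith [h.det]
    push_cast at hn
    linarith [hv' hu]

lemma IsReducedBasis.hasLowPositiveBasis (h : IsReducedBasis Λ u v) (hR : 0 < R)
    (hadm : ∀ l ∈ Λ, l ≠ 0 → l.2 = 0 → 2 * R < |l.1|) :
    HasLowPositiveBasis Λ (1 / (2 * R)) := by
  obtain ⟨Y, hY⟩ : ∃ Y, v.2 ≤ Y := ⟨_, le_rfl⟩
  have hY0 : 0 < Y := (h.nonneg.trans_lt h.lt).trans_le hY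
  obtain ⟨n, hn⟩ : ∃ n : ℕ, -u.1 < n * (1 / Y) := by
    obtain ⟨n, hn⟩ := exists_nat_gt (-u.1 / (1 / Y))
    exact ⟨n, (div_lt_iff₀ (by positivity)).mp hn⟩
  induction n generalizing u v with
  | zero => exact h.hasLowPositiveBasis_of_pos hR hadm (by simpa using hn)
  | succ n ih =>
    rcases h.nonneg.eq_or_lt with h0 | h0
    · exact h.hasLowPositiveBasis_of_snd_eq_zero hR hadm h0.symm
    rcases lt_or_ge 0 u.1 with hu | hu
    · exact h.hasLowPositiveBasis_of_pos hR hadm hu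
    obtain ⟨u', v', h', hhalf, hu', -, -⟩ := h.exists_euclid_step h0
    have hvpos := h0.trans h.lt
    refine ih h' (by linarith) ?_
    have hgain : 1 / Y ≤ 1 / v.2 := one_div_le_one_div_of_le hvpos hY
    push_cast at hn
    linarith [hu' hu]

end

/-- Every unimodular lattice whose horizontal slits of length 2R are pairwise
disjoint admits a positive basis whose second coordinates are both < 1/(2R). -/
theorem stmt_1 (R : ℝ) (hR : 0 < R) (Λ : Set (ℝ × ℝ)) (a b : ℝ × ℝ)
    (hdet : |a.1 * b.2 - a.2 * b.1| = 1)
    (hΛ : Λ = latticeOf a b)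
    (hadm : ∀ l ∈ Λ, l ≠ 0 → l.2 = 0 → 2 * R < |l.1|) :
    ∃ gp gm : ℝ × ℝ, gp ∈ Rpp ∧ gm ∈ Rmp ∧ Λ = latticeOf gp gm ∧
      0 ≤ gp.2 ∧ gp.2 < 1 / (2 * R) ∧ 0 < gm.2 ∧ gm.2 < 1 / (2 * R) := by
  subst hΛ
  obtain ⟨u, v, h⟩ := exists_isReducedBasis a b hdet
  exact h.hasLowPositiveBasis hR hadm
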